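/- (Path counting, intermediate overlap.) For a permutation σ of {1,…,n}, let k(σ) = #{ i ∈ {1,…,n} : σ({1,…,i−1}) = {1,…,i−1} and σ(i) = i }, and let f(n,k) = #{ σ : k(σ) = k }. There exists N such that for all n ≥ N and every k with 1 ≤ k ≤ n − 5e(n+3)^{2/3}: f(n,k) ≤ n^6 · (n−k)!. -/

import Mathlib

open Filter

/-- The path of `σ` shares its `i`-th edge (0-indexed) with the identity path exactly when
`σ` maps `{0, …, i-1}` onto itself and `σ i = i`. -/
def sharedEdge {n : ℕ} (σ : Equiv.Perm (Fin n)) (i : Fin n) : Prop :=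
  (Finset.univ.filter (fun j => j < i)).image σ = Finset.univ.filter (fun j => j < i) ∧ σ i = i

instance {n : ℕ} (σ : Equiv.Perm (Fin n)) (i : Fin n) : Decidable (sharedEdge σ i) := by
  unfold sharedEdge; infer_instance

/-- The number of edges the path of `σ` shares with the identity path. -/
def kShared {n : ℕ} (σ : Equiv.Perm (Fin n)) : ℕ :=
  (Finset.univ.filter (fun i => sharedEdge σ i)).card

/-- `f(n,k)`: the number of permutations of `{1,…,n}` whose path shares precisely `k` edges
with the identity path. -/
def fCount (n k : ℕ) : ℕ :=
  (Finset.univ.filter (fun σ : Equiv.Perm (Fin n) => kShared σ = k)).card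

lemma sharedEdge_iff {n : ℕ} (σ : Equiv.Perm (Fin n)) (i : Fin n) :
    sharedEdge σ i ↔ (∀ j, j < i → σ j < i) ∧ σ i = i := by
  unfold sharedEdge
  refine and_congr_left fun _ => ⟨fun h j hj => ?_, fun h => ?_⟩
  · have : σ j ∈ (Finset.univ.filter (fun j => j < i)).image σ :=
      Finset.mem_image_of_mem _ (by simpa using hj)
    rw [h] at this
    simpa using this
  · apply Finset.eq_of_subset_of_card_le
    · intro x hx
      simp only [Finset.mem_image, Finset.mem_filter, Finset.mem_univ, true_and] at hx ⊢
      obtain ⟨j, hj, rfl⟩ := hx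
      exact h j hj
    · rw [Finset.card_image_of_injective _ σ.injective]

/-- factorial for arguments at least two, zero otherwise -/
def dd (g : ℕ) : ℕ := if g < 2 then 0 else g.factorial

/-- weight of a block without shared edges -/
def cc (g : ℕ) : ℕ := if g = 1 then 0 else g.factorial

/-- permutations with `k+1` shared edges, the last one being `i` -/
def LastAt (n k : ℕ) (i : Fin n) : Finset (Equiv.Perm (Fin n)) :=
  Finset.univ.filter (fun σ => kShared σ = k + 1 ∧ sharedEdge σ i ∧ ∀ j, i < j → ¬ sharedEdge σ j)

/-- restriction to the lower block -/
noncomputable def lowPerm {n : ℕ} (σ : Equiv.Perm (Fin n)) (i : Fin n)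
    (h : sharedEdge σ i) : Equiv.Perm (Fin i.val) :=
  Equiv.ofBijective (fun x : Fin i.val => (⟨(σ ⟨x.val, x.2.trans i.2⟩).val,
      ((sharedEdge_iff σ i).1 h).1 ⟨x.val, x.2.trans i.2⟩ x.2⟩ : Fin i.val))
    (Finite.injective_iff_bijective.1 (by
      intro x y hxy
      simp only [Fin.mk.injEq] at hxy
      have := σ.injective (Fin.ext hxy)
      simp only [Fin.mk.injEq] at this
      exact Fin.ext this))

lemma shared_up {n : ℕ} (σ : Equiv.Perm (Fin n)) (i : Fin n)
    (h : sharedEdge σ i) (x : Fin n) (hx : i < x) : i < σ x := by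
  obtain ⟨h1, h2⟩ := (sharedEdge_iff σ i).1 h
  by_contra hc
  have hle : σ x ≤ i := not_lt.1 hc
  have hS : (Finset.univ.filter (fun j => j < i)).image σ
      = Finset.univ.filter (fun j => j < i) := h.1
  rcases hle.lt_or_eq with h3 | h3
  · have : σ x ∈ (Finset.univ.filter (fun j => j < i)).image σ := by
      rw [hS]; simpa using h3
    simp only [Finset.mem_image, Finset.mem_filter, Finset.mem_univ, true_and] at this
    obtain ⟨j, hj, hjx⟩ := this
    have := σ.injective hjx
    subst this
    exact absurd hj (not_lt.2 hx.le)
  · rw [← h2] at h3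
    have := σ.injective h3
    exact absurd hx (by rw [this]; exact lt_irrefl _)

/-- restriction to the upper block -/
noncomputable def highPerm {n : ℕ} (σ : Equiv.Perm (Fin n)) (i : Fin n)
    (h : sharedEdge σ i) : Equiv.Perm (Fin (n - 1 - i.val)) :=
  Equiv.ofBijective (fun x : Fin (n - 1 - i.val) =>
      (⟨(σ ⟨i.val + 1 + x.val, by omega⟩).val - (i.val + 1), by
        have := shared_up σ i h ⟨i.val + 1 + x.val, by omega⟩ (by
          rw [Fin.lt_def]; show i.val < i.val + 1 + x.val; omega)
        rw [Fin.lt_def] at this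
        omega⟩ : Fin (n - 1 - i.val)))
    (Finite.injective_iff_bijective.1 (by
      intro x y hxy
      simp only [Fin.mk.injEq] at hxy
      have h1 := shared_up σ i h ⟨i.val + 1 + x.val, by omega⟩ (by
          rw [Fin.lt_def]; show i.val < i.val + 1 + x.val; omega)
      have h2 := shared_up σ i h ⟨i.val + 1 + y.val, by omega⟩ (by
          rw [Fin.lt_def]; show i.val < i.val + 1 + y.val; omega)
      rw [Fin.lt_def] at h1 h2
      have := σ.injective (Fin.ext (by omega) :
        σ ⟨i.val + 1 + x.val, by omega⟩ = σ ⟨i.val + 1 + y.val, by omega⟩)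
      simp only [Fin.mk.injEq] at this
      exact Fin.ext (by omega)))

lemma lowPerm_shared {n : ℕ} (σ : Equiv.Perm (Fin n)) (i : Fin n)
    (h : sharedEdge σ i) (x : Fin i.val) :
    sharedEdge (lowPerm σ i h) x ↔ sharedEdge σ ⟨x.val, x.2.trans i.2⟩ := by
  rw [sharedEdge_iff, sharedEdge_iff]
  simp only [lowPerm, Equiv.ofBijective_apply, Fin.lt_def, Fin.ext_iff]
  refine and_congr_left fun _ => ⟨fun H j hj => ?_, fun H j hj => ?_⟩
  · exact H ⟨j.val, hj.trans x.2⟩ hj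
  · exact H ⟨j.val, j.2.trans i.2⟩ hj

lemma lowPerm_kShared {n k : ℕ} (σ : Equiv.Perm (Fin n)) (i : Fin n)
    (h : sharedEdge σ i) (hk : kShared σ = k + 1) (hl : ∀ j, i < j → ¬ sharedEdge σ j) :
    kShared (lowPerm σ i h) = k := by
  have key : Finset.univ.filter (fun j => sharedEdge σ j) =
      insert i ((Finset.univ.filter (fun x => sharedEdge (lowPerm σ i h) x)).image
        (fun x : Fin i.val => (⟨x.val, x.2.trans i.2⟩ : Fin n))) := by
    ext j
    simp only [Finset.mem_filter, Finset.mem_univ, true_and, Finset.mem_insert, Finset.mem_image,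
      lowPerm_shared]
    constructor
    · intro hj
      rcases lt_trichotomy j i with h1 | h1 | h1
      · exact Or.inr ⟨⟨j.val, h1⟩, hj, rfl⟩
      · exact Or.inl h1
      · exact absurd hj (hl j h1)
    · rintro (rfl | ⟨x, hx, rfl⟩)
      · exact h
      · exact hx
  unfold kShared at hk ⊢
  rw [key, Finset.card_insert_of_notMem, Finset.card_image_of_injective] at hk
  · omega
  · intro x y hxy
    simp only [Fin.mk.injEq] at hxy
    exact Fin.ext hxy
  · simp only [Finset.mem_image, not_exists, not_and]
    intro x _ hx
    have := x.2
    have := congrArg Fin.val hx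
    simp only at this
    omega

lemma lastAt_card (n k : ℕ) (i : Fin n) :
    (LastAt n k i).card ≤ fCount i.val k * cc (n - 1 - i.val) := by
  by_cases hg : n - 1 - i.val = 1
  · have : LastAt n k i = ∅ := by
      rw [Finset.eq_empty_iff_forall_notMem]
      intro σ hσ
      simp only [LastAt, Finset.mem_filter, Finset.mem_univ, true_and] at hσ
      obtain ⟨_, h, hl⟩ := hσ
      refine hl ⟨i.val + 1, by omega⟩ (by rw [Fin.lt_def]; simp) ?_
      have hi := (sharedEdge_iff σ i).1 h
      rw [sharedEdge_iff]
      constructor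
      · intro j hj
        have hj' : j.val < i.val + 1 := hj
        rw [Fin.lt_def]
        show (σ j).val < i.val + 1
        rcases Nat.lt_succ_iff_lt_or_eq.1 hj' with h1 | h1
        · have := hi.1 j h1
          rw [Fin.lt_def] at this
          omega
        · have : j = i := Fin.ext h1
          rw [this, hi.2]; omega
      · have := shared_up σ i h ⟨i.val + 1, by omega⟩ (by rw [Fin.lt_def]; simp)
        rw [Fin.lt_def] at this
        apply Fin.ext
        show _ = i.val + 1
        omega
    rw [this]; simp
  · have hc : cc (n - 1 - i.val) = Fintype.card (Equiv.Perm (Fin (n - 1 - i.val))) := by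
      rw [Fintype.card_perm, Fintype.card_fin, cc, if_neg hg]
    rw [hc, fCount, ← Finset.card_univ, ← Finset.card_product, ← Fintype.card_coe,
      ← Fintype.card_coe]
    have hmem : ∀ σ : LastAt n k i, kShared σ.1 = k + 1 ∧ sharedEdge σ.1 i ∧
        ∀ j, i < j → ¬ sharedEdge σ.1 j := fun σ => by
      have := σ.2
      simpa only [LastAt, Finset.mem_filter, Finset.mem_univ, true_and] using this
    refine Fintype.card_le_of_injective (fun σ => ⟨(lowPerm σ.1 i (hmem σ).2.1,
      highPerm σ.1 i (hmem σ).2.1), ?_⟩) ?_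
    · simp only [Finset.mem_product, Finset.mem_filter, Finset.mem_univ, true_and, and_true]
      exact lowPerm_kShared _ _ _ (hmem σ).1 (hmem σ).2.2
    · intro σ τ hst
      simp only [Subtype.mk.injEq, Prod.mk.injEq] at hst
      obtain ⟨h1, h2⟩ := hst
      apply Subtype.ext
      apply Equiv.ext
      intro x
      rcases lt_trichotomy x i with hx | hx | hx
      · have := congrArg Fin.val (Equiv.congr_fun h1 ⟨x.val, hx⟩)
        simp only [lowPerm, Equiv.ofBijective_apply] at this
        exact Fin.ext this
      · rw [hx, ((sharedEdge_iff _ i).1 (hmem σ).2.1).2, ((sharedEdge_iff _ i).1 (hmem τ).2.1).2]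
      · have hx' : i.val < x.val := hx
        have := congrArg Fin.val (Equiv.congr_fun h2 ⟨x.val - (i.val + 1), by omega⟩)
        simp only [highPerm, Equiv.ofBijective_apply] at this
        have hxx : (⟨i.val + 1 + (x.val - (i.val + 1)), by omega⟩ : Fin n) = x :=
          Fin.ext (by simp only; omega)
        rw [hxx] at this
        have a1 := shared_up _ i (hmem σ).2.1 x hx
        have a2 := shared_up _ i (hmem τ).2.1 x hx
        rw [Fin.lt_def] at a1 a2
        exact Fin.ext (by omega)

lemma fCount_succ_le (n k : ℕ) :
    fCount n (k + 1) ≤ ∑ i ∈ Finset.range n, fCount i k * cc (n - 1 - i) := by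
  rw [Finset.sum_range]
  refine le_trans ?_ (Finset.sum_le_sum fun i _ => lastAt_card n k i)
  refine le_trans (Finset.card_le_card ?_) Finset.card_biUnion_le
  intro σ hσ
  simp only [Finset.mem_filter, Finset.mem_univ, true_and] at hσ
  simp only [Finset.mem_biUnion, Finset.mem_univ, true_and, LastAt, Finset.mem_filter]
  have hne : (Finset.univ.filter (fun i => sharedEdge σ i)).Nonempty := by
    rw [← Finset.card_pos]
    unfold kShared at hσ
    omega
  refine ⟨Finset.max' _ hne, hσ, ?_, ?_⟩
  · have := Finset.max'_mem _ hne
    simpa only [Finset.mem_filter, Finset.mem_univ, true_and] using this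
  · intro j hj hs
    exact absurd hj (not_lt.2 (Finset.le_max' _ j (by simpa using hs)))

lemma fCount_eq_zero (n k : ℕ) (h : n < k) : fCount n k = 0 := by
  unfold fCount
  rw [Finset.card_eq_zero, Finset.filter_eq_empty_iff]
  intro σ _ hs
  have : kShared σ ≤ n := by
    unfold kShared
    exact (Finset.card_le_univ _).trans (by simp)
  omega

lemma fCount_zero_le (m : ℕ) : fCount m 0 ≤ cc m := by
  unfold cc
  split_ifs with h
  · subst h
    unfold fCount
    rw [Nat.le_zero, Finset.card_eq_zero, Finset.filter_eq_empty_iff]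
    intro σ _ hs
    unfold kShared at hs
    rw [Finset.card_eq_zero, Finset.filter_eq_empty_iff] at hs
    refine hs (Finset.mem_univ 0) ((sharedEdge_iff _ _).2 ⟨fun j hj => ?_, Subsingleton.elim _ _⟩)
    exact absurd hj (by rw [Subsingleton.elim j 0]; exact lt_irrefl _)
  · unfold fCount
    refine (Finset.card_le_univ _).trans ?_
    rw [Fintype.card_perm, Fintype.card_fin]

lemma fact2 (g h : ℕ) :
    (g + 3).factorial * (h + 3).factorial ≤ 6 * (g + h + 3).factorial := by
  induction h with
  | zero => simp [Nat.factorial]; ring_nf; omega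
  | succ h ih =>
    have e1 : (h + 1 + 3).factorial = (h + 4) * (h + 3).factorial := Nat.factorial_succ _
    have e2 : (g + (h + 1) + 3).factorial = (g + h + 4) * (g + h + 3).factorial :=
      Nat.factorial_succ _
    rw [e1, e2]
    calc (g + 3).factorial * ((h + 4) * (h + 3).factorial)
        = (h + 4) * ((g + 3).factorial * (h + 3).factorial) := by ring
      _ ≤ (g + h + 4) * (6 * (g + h + 3).factorial) := Nat.mul_le_mul (by omega) ih
      _ = _ := by ring

lemma fact_sum (t : ℕ) : ∑ a ∈ Finset.range (t + 1),
    (t + 2 - a).factorial * (a + 2).factorial ≤ 10 * (t + 2).factorial := by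
  have hp : ∀ a ∈ Finset.range (t + 1), (t + 2 - a).factorial * (a + 2).factorial ≤
      (if a = 0 then 2 * (t + 2).factorial else 0) + (if a = t then 2 * (t + 2).factorial else 0)
        + 6 * (t + 1).factorial := by
    intro a ha
    rw [Finset.mem_range] at ha
    by_cases h0 : a = 0
    · subst h0
      simp only [if_true, Nat.sub_zero, zero_add, Nat.factorial_two]
      omega
    by_cases h1 : a = t
    · subst h1
      have : a + 2 - a = 2 := by omega
      simp only [if_true, this, Nat.factorial_two]
      omega
    · obtain ⟨b, rfl⟩ : ∃ b, a = b + 1 := ⟨a - 1, by omega⟩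
      obtain ⟨c, rfl⟩ : ∃ c, t = b + 1 + c + 1 := ⟨t - b - 2, by omega⟩
      have := fact2 c b
      have e1 : b + 1 + c + 1 + 2 - (b + 1) = c + 3 := by omega
      have e2 : b + 1 + c + 1 + 1 = c + b + 3 := by omega
      rw [e1, e2]
      exact this.trans (Nat.le_add_left _ _)
  refine (Finset.sum_le_sum hp).trans ?_
  rw [Finset.sum_add_distrib, Finset.sum_add_distrib, Finset.sum_ite_eq', Finset.sum_ite_eq',
    Finset.sum_const, Finset.card_range]
  have : (t + 2).factorial = (t + 2) * (t + 1).factorial := Nat.factorial_succ _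
  simp only [Finset.mem_range, Nat.succ_pos, if_true, Nat.lt_succ_self, smul_eq_mul, this]
  nlinarith [Nat.factorial_pos (t + 1)]

lemma dd_conv (M : ℕ) : ∑ x ∈ Finset.range (M + 1), dd (M - x) * dd x ≤ 10 * dd (M - 2) := by
  by_cases hM : M < 4
  · rw [Finset.sum_eq_zero]
    · exact Nat.zero_le _
    · intro x hx
      rw [Finset.mem_range] at hx
      unfold dd
      split_ifs <;> simp
      omega
  obtain ⟨t, rfl⟩ : ∃ t, M = t + 4 := ⟨M - 4, by omega⟩
  rw [Finset.sum_range_succ, Finset.sum_range_succ, Finset.sum_range_succ', Finset.sum_range_succ']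
  have e0 : dd (t + 4 - (t + 4)) = 0 := by simp [dd]
  have e1 : dd (t + 4 - (t + 3)) = 0 := by
    have : t + 4 - (t + 3) = 1 := by omega
    simp [this, dd]
  have e2 : dd 0 = 0 := by simp [dd]
  have e3 : dd (0 + 1) = 0 := by simp [dd]
  rw [e0, e1, e2, e3]
  simp only [zero_mul, mul_zero, add_zero]
  have e4 : dd (t + 4 - 2) = (t + 2).factorial := by
    have : t + 4 - 2 = t + 2 := by omega
    simp [this, dd]
  rw [e4]
  refine le_trans (le_of_eq (Finset.sum_congr rfl fun a ha => ?_)) (fact_sum t)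
  rw [Finset.mem_range] at ha
  have : t + 4 - (a + 1 + 1) = t + 2 - a := by omega
  rw [this]
  unfold dd
  rw [if_neg (by omega), if_neg (by omega)]

lemma dd_conv' (m i : ℕ) :
    ∑ x ∈ Finset.range (m + 1), dd (m - x) * dd (x - 2 * i) ≤ 10 * dd (m - 2 * (i + 1)) := by
  by_cases h : m < 2 * i
  · rw [Finset.sum_eq_zero]
    · exact Nat.zero_le _
    · intro x hx
      rw [Finset.mem_range] at hx
      have : x - 2 * i = 0 := by omega
      simp [this, dd]
  obtain ⟨M, rfl⟩ : ∃ M, m = 2 * i + M := ⟨m - 2 * i, by omega⟩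
  rw [add_assoc, Finset.sum_range_add, Finset.sum_eq_zero, zero_add]
  · have : 2 * i + M - 2 * (i + 1) = M - 2 := by omega
    rw [this]
    refine le_trans (le_of_eq (Finset.sum_congr rfl fun a ha => ?_)) (dd_conv M)
    rw [Nat.add_sub_cancel_left, Nat.add_sub_add_left]
  · intro x hx
    rw [Finset.mem_range] at hx
    have : x - 2 * i = 0 := by omega
    simp [this, dd]

/-- The explicit upper bound. -/
def UU (N K m : ℕ) : ℕ :=
  (if m = 0 then 1 else 0) + ∑ i ∈ Finset.range N, K ^ (i + 1) * 10 ^ i * dd (m - 2 * i)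

lemma cc_eq (g : ℕ) : cc g = (if g = 0 then 1 else 0) + dd g := by
  unfold cc dd
  rcases g with _ | _ | g <;> simp

lemma UU_conv (N K m : ℕ) (hm : m < N) :
    ∑ x ∈ Finset.range (m + 1), UU N K x * cc (m - x) ≤ UU N (K + 1) m := by
  have h1 : ∑ x ∈ Finset.range (m + 1), UU N K x * cc (m - x)
      = UU N K m + ∑ x ∈ Finset.range (m + 1), UU N K x * dd (m - x) := by
    simp only [cc_eq, mul_add, Finset.sum_add_distrib]
    congr 1
    rw [Finset.sum_range_succ, Finset.sum_eq_zero]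
    · simp
    · intro x hx
      rw [Finset.mem_range] at hx
      rw [if_neg (by omega), mul_zero]
  have h2 : ∑ x ∈ Finset.range (m + 1), UU N K x * dd (m - x)
      = dd m + ∑ i ∈ Finset.range N, K ^ (i + 1) * 10 ^ i *
        ∑ x ∈ Finset.range (m + 1), dd (m - x) * dd (x - 2 * i) := by
    simp only [UU, add_mul, Finset.sum_add_distrib]
    congr 1
    · rw [Finset.sum_range_succ', Finset.sum_eq_zero]
      · simp
      · intro x hx
        simp
    · simp only [Finset.sum_mul, Finset.mul_sum]
      rw [Finset.sum_comm]
      refine Finset.sum_congr rfl fun i _ => Finset.sum_congr rfl fun x _ => ?_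
      ring
  have h3 : ∑ i ∈ Finset.range N, K ^ (i + 1) * 10 ^ i *
        ∑ x ∈ Finset.range (m + 1), dd (m - x) * dd (x - 2 * i)
      ≤ ∑ i ∈ Finset.range N, K ^ (i + 1) * 10 ^ (i + 1) * dd (m - 2 * (i + 1)) := by
    refine Finset.sum_le_sum fun i _ => ?_
    refine (Nat.mul_le_mul_left _ (dd_conv' m i)).trans (le_of_eq ?_)
    ring
  have h4 : dd m + ∑ i ∈ Finset.range N, K ^ (i + 1) * 10 ^ (i + 1) * dd (m - 2 * (i + 1))
      = ∑ i ∈ Finset.range N, K ^ i * 10 ^ i * dd (m - 2 * i) := by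
    have h5 := Finset.sum_range_succ' (fun i => K ^ i * 10 ^ i * dd (m - 2 * i)) N
    rw [Finset.sum_range_succ] at h5
    have : m - 2 * N = 0 := by omega
    have e : dd 0 = 0 := by simp [dd]
    simp only [this, e, mul_zero, add_zero, pow_zero, one_mul, Nat.sub_zero] at h5
    omega
  rw [h1, h2]
  refine (Nat.add_le_add_left (Nat.add_le_add_left h3 _) _).trans ?_
  rw [h4]
  unfold UU
  rw [add_assoc, ← Finset.sum_add_distrib]
  refine Nat.add_le_add_left (Finset.sum_le_sum fun i _ => ?_) _
  have : K ^ (i + 1) + K ^ i ≤ (K + 1) ^ (i + 1) := by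
    have := Nat.pow_le_pow_left (Nat.le_succ K) i
    calc K ^ (i + 1) + K ^ i = K ^ i * (K + 1) := by ring
      _ ≤ (K + 1) ^ i * (K + 1) := Nat.mul_le_mul_right _ this
      _ = _ := by ring
  calc K ^ (i + 1) * 10 ^ i * dd (m - 2 * i) + K ^ i * 10 ^ i * dd (m - 2 * i)
      = (K ^ (i + 1) + K ^ i) * (10 ^ i * dd (m - 2 * i)) := by ring
    _ ≤ (K + 1) ^ (i + 1) * (10 ^ i * dd (m - 2 * i)) := Nat.mul_le_mul_right _ this
    _ = _ := by ring

lemma fCount_le_UU (N k : ℕ) : ∀ m, m < N → fCount (k + m) k ≤ UU N (k + 1) m := by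
  induction k with
  | zero =>
    intro m hm
    rw [zero_add]
    refine (fCount_zero_le m).trans ?_
    rw [cc_eq]
    unfold UU
    refine Nat.add_le_add_left ?_ _
    have := Finset.single_le_sum (s := Finset.range N)
      (f := fun i => (0 + 1) ^ (i + 1) * 10 ^ i * dd (m - 2 * i)) (fun _ _ => Nat.zero_le _)
      (Finset.mem_range.2 (show 0 < N by omega))
    simpa using this
  | succ k ih =>
    intro m hm
    refine (fCount_succ_le _ _).trans (le_trans ?_ (UU_conv N (k + 1) m hm))
    have e : k + 1 + m = k + (m + 1) := by omega
    rw [e, Finset.sum_range_add, Finset.sum_eq_zero, zero_add]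
    · refine Finset.sum_le_sum fun x hx => ?_
      rw [Finset.mem_range] at hx
      have : k + (m + 1) - 1 - (k + x) = m - x := by omega
      rw [this]
      exact Nat.mul_le_mul_right _ (ih x (by omega))
    · intro x hx
      rw [Finset.mem_range] at hx
      rw [fCount_eq_zero _ _ hx, zero_mul]

lemma pow_fact (m p : ℕ) (hp : p ≤ m) :
    ((m : ℝ) / Real.exp 1) ^ p * (m - p).factorial ≤ m.factorial := by
  have he : (1 : ℝ) ≤ Real.exp 1 := Real.one_le_exp (by norm_num)
  by_cases h : (m : ℝ) / Real.exp 1 ≤ ((m - p : ℕ) : ℝ)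
  · have h1 : (m + 1 - p) ^ p ≤ m.descFactorial p := Nat.pow_sub_le_descFactorial m p
    have h2 : (m - p).factorial * m.descFactorial p = m.factorial :=
      Nat.factorial_mul_descFactorial hp
    have h3 : ((m : ℝ) / Real.exp 1) ^ p ≤ (m.descFactorial p : ℝ) := by
      refine le_trans (pow_le_pow_left₀ (by positivity) h p) ?_
      have : (m - p) ^ p ≤ m.descFactorial p :=
        (Nat.pow_le_pow_left (by omega) p).trans h1
      exact_mod_cast this
    rw [← h2]
    push_cast
    rw [mul_comm]
    gcongr
  · push Not at h
    have h1 : ((m - p).factorial : ℝ) ≤ ((m : ℝ) / Real.exp 1) ^ (m - p) := by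
      refine le_trans ?_ (pow_le_pow_left₀ (by positivity) h.le _)
      exact_mod_cast Nat.factorial_le_pow (m - p)
    have h2 : ((m : ℝ) / Real.exp 1) ^ m ≤ m.factorial := by
      have := Real.pow_div_factorial_le_exp (m : ℝ) (by positivity) m
      rw [div_pow, ← Real.exp_nat_mul, mul_one, div_le_iff₀ (Real.exp_pos _)]
      rw [div_le_iff₀ (by positivity)] at this
      linarith
    calc ((m : ℝ) / Real.exp 1) ^ p * (m - p).factorial
        ≤ ((m : ℝ) / Real.exp 1) ^ p * ((m : ℝ) / Real.exp 1) ^ (m - p) := by gcongr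
      _ = ((m : ℝ) / Real.exp 1) ^ m := by rw [← pow_add]; congr 1; omega
      _ ≤ _ := h2

/-- Path counting, intermediate overlap: for large `n` and `1 ≤ k ≤ n - 5e(n+3)^{2/3}`,
`f(n,k) ≤ n^6 (n-k)!`. -/
theorem path_counting_intermediate_overlap :
    ∃ N : ℕ, ∀ n ≥ N, ∀ k : ℕ, 1 ≤ k →
      (k : ℝ) ≤ (n : ℝ) - 5 * Real.exp 1 * ((n : ℝ) + 3) ^ ((2 : ℝ) / 3) →
      (fCount n k : ℝ) ≤ (n : ℝ) ^ 6 * (n - k).factorial := by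
  refine ⟨1, fun n hn k hk hkn => ?_⟩
  have hn3 : (1 : ℝ) ≤ (n : ℝ) + 3 := by
    have : (0 : ℝ) ≤ n := Nat.cast_nonneg n
    linarith
  have hr0 : (1 : ℝ) ≤ ((n : ℝ) + 3) ^ ((2 : ℝ) / 3) := Real.one_le_rpow hn3 (by norm_num)
  have he : (1 : ℝ) ≤ Real.exp 1 := Real.one_le_exp (by norm_num)
  have hpos : (5 : ℝ) ≤ 5 * Real.exp 1 * ((n : ℝ) + 3) ^ ((2 : ℝ) / 3) := by nlinarith
  have hlt : k < n := by
    have : (k : ℝ) < n := by linarith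
    exact_mod_cast this
  obtain ⟨m, rfl⟩ : ∃ m, n = k + m := ⟨n - k, by omega⟩
  have hm : 5 * Real.exp 1 * (((k + m : ℕ) : ℝ) + 3) ^ ((2 : ℝ) / 3) ≤ m := by
    have : ((k + m : ℕ) : ℝ) = k + m := by push_cast; ring
    linarith
  have hD : 10 * ((k : ℝ) + 1) ≤ ((m : ℝ) / Real.exp 1) ^ 2 := by
    have h1 : 5 * (((k + m : ℕ) : ℝ) + 3) ^ ((2 : ℝ) / 3) ≤ (m : ℝ) / Real.exp 1 := by
      rw [le_div_iff₀ (Real.exp_pos _)]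
      linarith
    have h2 : ((k + m : ℕ) : ℝ) + 3 ≤ ((((k + m : ℕ) : ℝ) + 3) ^ ((2 : ℝ) / 3)) ^ 2 := by
      rw [← Real.rpow_natCast, ← Real.rpow_mul (by linarith)]
      calc ((k + m : ℕ) : ℝ) + 3 = (((k + m : ℕ) : ℝ) + 3) ^ (1 : ℝ) := (Real.rpow_one _).symm
        _ ≤ _ := Real.rpow_le_rpow_of_exponent_le hn3 (by norm_num)
    have h3 := pow_le_pow_left₀ (by linarith) h1 2
    have h4 : (k : ℝ) ≤ ((k + m : ℕ) : ℝ) := by exact_mod_cast Nat.le_add_right k m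
    have h5 : (0 : ℝ) ≤ k := Nat.cast_nonneg k
    nlinarith
  have hm1 : m ≠ 0 := by omega
  have hterm : ∀ i ∈ Finset.range (m + 1),
      (((k + 1) ^ (i + 1) * 10 ^ i * dd (m - 2 * i) : ℕ) : ℝ) ≤ ((k : ℝ) + 1) * m.factorial := by
    intro i _
    by_cases h : m - 2 * i < 2
    · have : dd (m - 2 * i) = 0 := by simp [dd, h]
      rw [this, mul_zero, Nat.cast_zero]
      positivity
    · have e : dd (m - 2 * i) = (m - 2 * i).factorial := by simp only [dd, if_neg h]
      rw [e]
      have h1 := pow_fact m (2 * i) (by omega)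
      rw [pow_mul] at h1
      have h2 := pow_le_pow_left₀ (by positivity) hD i
      push_cast
      calc ((k : ℝ) + 1) ^ (i + 1) * 10 ^ i * ((m - 2 * i).factorial : ℝ)
          = ((k : ℝ) + 1) * ((10 * ((k : ℝ) + 1)) ^ i * ((m - 2 * i).factorial : ℝ)) := by
            rw [mul_pow]; ring
        _ ≤ ((k : ℝ) + 1) * ((((m : ℝ) / Real.exp 1) ^ 2) ^ i * ((m - 2 * i).factorial : ℝ)) := by
            gcongr
        _ ≤ _ := by gcongr
  have hU : ((UU (m + 1) (k + 1) m : ℕ) : ℝ) ≤ ((m : ℝ) + 1) * (((k : ℝ) + 1) * m.factorial) := by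
    unfold UU
    rw [if_neg hm1, zero_add, Nat.cast_sum]
    refine (Finset.sum_le_sum hterm).trans (le_of_eq ?_)
    rw [Finset.sum_const, Finset.card_range, nsmul_eq_mul]
    push_cast
    ring
  have hf : (fCount (k + m) k : ℝ) ≤ (UU (m + 1) (k + 1) m : ℕ) := by
    exact_mod_cast fCount_le_UU (m + 1) k m (Nat.lt_succ_self m)
  refine hf.trans (hU.trans ?_)
  rw [Nat.add_sub_cancel_left, ← mul_assoc]
  gcongr
  have a1 : (m : ℝ) + 1 ≤ ((k + m : ℕ) : ℝ) := by exact_mod_cast (show m + 1 ≤ k + m by omega)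
  have a2 : (k : ℝ) + 1 ≤ ((k + m : ℕ) : ℝ) := by exact_mod_cast (show k + 1 ≤ k + m by omega)
  have a3 : (1 : ℝ) ≤ ((k + m : ℕ) : ℝ) := by exact_mod_cast hn
  calc ((m : ℝ) + 1) * ((k : ℝ) + 1) ≤ ((k + m : ℕ) : ℝ) * ((k + m : ℕ) : ℝ) := by gcongr
    _ = ((k + m : ℕ) : ℝ) ^ 2 := by ring
    _ ≤ _ := pow_le_pow_right₀ a3 (by norm_num)
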